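/- Let d ≥ 3 be an integer and s = binom(d,2) + 1. If X is a set of s distinct points of P^2 with generic Hilbert function, then H_{2X}(t) = binom(t+2,2) for all t ≤ d; equivalently, the ideal I_{2X} contains no nonzero form of degree ≤ d. -/

import Mathlib

open MvPolynomial

/-- The vanishing (prime) ideal of a point of ℙ²: the ideal generated by the
linear forms vanishing at the point. -/
noncomputable def pointIdeal (k : Type) [Field k] (P : Projectivization k (Fin 3 → k)) :
    Ideal (MvPolynomial (Fin 3) k) :=
  Ideal.span {f : MvPolynomial (Fin 3) k | f.IsHomogeneous 1 ∧ eval P.rep f = 0}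

/-- The Hilbert function of R/I: H(t) = dim_k R_t − dim_k I_t. -/
noncomputable def hilbertFunction (k : Type) [Field k]
    (I : Ideal (MvPolynomial (Fin 3) k)) (t : ℕ) : ℕ :=
  Module.finrank k ↥(homogeneousSubmodule (Fin 3) k t) -
    Module.finrank k ↥(Submodule.restrictScalars k I ⊓ homogeneousSubmodule (Fin 3) k t)

/-- The defining ideal `I_X` of a finite set of points. -/
noncomputable def idealOfPoints (k : Type) [Field k] {s : ℕ}
    (P : Fin s → Projectivization k (Fin 3 → k)) : Ideal (MvPolynomial (Fin 3) k) :=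
  ⨅ i, pointIdeal k (P i)

/-- The defining ideal `I_{2X}` of the double point scheme supported on a finite set of points. -/
noncomputable def doubleIdealOfPoints (k : Type) [Field k] {s : ℕ}
    (P : Fin s → Projectivization k (Fin 3 → k)) : Ideal (MvPolynomial (Fin 3) k) :=
  ⨅ i, (pointIdeal k (P i)) ^ 2

/-- `X` has generic Hilbert function: `H_X(t) = min {s, binom(t+2,2)}` for all `t`. -/
def HasGenericHilbertFunction (k : Type) [Field k] {s : ℕ}
    (P : Fin s → Projectivization k (Fin 3 → k)) : Prop :=
  ∀ t : ℕ, hilbertFunction k (idealOfPoints k P) t = min s (Nat.choose (t + 2) 2)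

section Forms

variable {k : Type} [Field k] {σ : Type*}

/-- The homogeneous forms of degree `n` in three variables have dimension `(n + 2).choose 2`. -/
theorem finrank_homogeneousSubmodule_fin_three (n : ℕ) :
    Module.finrank k (homogeneousSubmodule (Fin 3) k n) = (n + 2).choose 2 := by
  rw [homogeneousSubmodule_eq_finsupp_supported,
    (AddMonoidAlgebra.supportedEquivFinsupp {d : Fin 3 →₀ ℕ | d.degree = n}).finrank_eq]
  have h : {d : Fin 3 →₀ ℕ | d.degree = n} =
      ((Finset.univ : Finset (Fin 3)).finsuppAntidiag n : Set (Fin 3 →₀ ℕ)) := by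
    ext d
    simp [Finsupp.degree_eq_sum]
  rw [h, Module.finrank_finsupp_self, Fintype.card_eq_nat_card, Nat.card_coe_set_eq,
    Set.ncard_coe_finset, Finset.card_finsuppAntidiag_nat_eq_choose]
  rw [Finset.card_univ, Fintype.card_fin, show 3 + n - 1 = n + 2 by omega, Nat.choose_symm_add]

instance finite_homogeneousSubmodule [Finite σ] (n : ℕ) :
    Module.Finite k (homogeneousSubmodule σ k n) :=
  Module.Finite.iff_fg.mpr (homogeneousSubmodule_fg σ k n)

theorem homogeneousComponent_add_mul {m n : ℕ} {f g : MvPolynomial σ k}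
    (hf : f.totalDegree ≤ m) (hg : g.totalDegree ≤ n) :
    homogeneousComponent (m + n) (f * g) =
      homogeneousComponent m f * homogeneousComponent n g := by
  have hsum : ∀ {p : MvPolynomial σ k} {r : ℕ}, p.totalDegree ≤ r →
      ∑ i ∈ Finset.range (r + 1), homogeneousComponent i p = p := by
    intro p r hr
    conv_rhs => rw [← sum_homogeneousComponent p]
    refine (Finset.sum_subset (Finset.range_mono (by omega)) fun i _ hi ↦ ?_).symm
    exact homogeneousComponent_eq_zero _ _ (by simpa using hi)
  conv_lhs => rw [← hsum hf, ← hsum hg, Finset.sum_mul_sum]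
  simp only [map_sum]
  have hterm : ∀ i j, homogeneousComponent (m + n)
      (homogeneousComponent i f * homogeneousComponent j g) =
      if m + n = i + j then homogeneousComponent i f * homogeneousComponent j g else 0 :=
    fun i j ↦ homogeneousComponent_of_mem
      ((homogeneousComponent_isHomogeneous i f).mul (homogeneousComponent_isHomogeneous j g))
  simp only [hterm]
  rw [Finset.sum_eq_single m, Finset.sum_eq_single n]
  · simp
  · intro j hj hne
    exact if_neg (by omega)
  · simp
  · intro i hi hne
    refine Finset.sum_eq_zero fun j hj ↦ if_neg ?_
    simp only [Finset.mem_range] at hi hj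
    omega
  · simp

theorem MvPolynomial.IsHomogeneous.of_mul_left {m n : ℕ} {f g : MvPolynomial σ k}
    (hf : f.IsHomogeneous m) (hf0 : f ≠ 0) (h : (f * g).IsHomogeneous (m + n)) :
    g.IsHomogeneous n := by
  let := gradedAlgebra (σ := σ) (R := k)
  have hg := DirectSum.coe_decompose_mul_of_left_mem_of_le (𝒜 := homogeneousSubmodule σ k) (b := g)
    (n := m + n) hf (Nat.le_add_right m n)
  rw [Nat.add_sub_cancel_left, DirectSum.decompose_of_mem_same _ h] at hg
  rw [mul_left_cancel₀ hf0 hg]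
  exact (DirectSum.decompose (homogeneousSubmodule σ k) g n).2

/-- A repeated factor of a form can be taken to be a form. -/
theorem exists_isHomogeneous_sq_mul {d : ℕ} {F : MvPolynomial σ k} (hF : F.IsHomogeneous d)
    (hF0 : F ≠ 0) (hsq : ¬ Squarefree F) :
    ∃ (e : ℕ) (Q K : MvPolynomial σ k), 1 ≤ e ∧ 2 * e ≤ d ∧ Q.IsHomogeneous e ∧
      K.IsHomogeneous (d - 2 * e) ∧ F = Q * Q * K := by
  simp only [Squarefree, not_forall] at hsq
  obtain ⟨Q, ⟨K, hQK⟩, hQ⟩ := hsq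
  have hK0 : K ≠ 0 := by rintro rfl; simp_all
  have hQ0 : Q ≠ 0 := by rintro rfl; simp_all
  have hdeg : d = Q.totalDegree + Q.totalDegree + K.totalDegree := by
    rw [← hF.totalDegree hF0, hQK, totalDegree_mul_of_isDomain (mul_ne_zero hQ0 hQ0) hK0,
      totalDegree_mul_of_isDomain hQ0 hQ0]
  refine ⟨Q.totalDegree, homogeneousComponent Q.totalDegree Q,
    homogeneousComponent K.totalDegree K, ?_, by omega,
    homogeneousComponent_isHomogeneous _ _, ?_, ?_⟩
  · by_contra! h
    have h0 : Q.totalDegree = 0 := by omega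
    rw [totalDegree_eq_zero_iff_eq_C] at h0
    refine hQ ?_
    rw [h0] at hQ0 ⊢
    exact (IsUnit.mk0 _ (by rintro h; simp [h] at hQ0)).map C
  · convert homogeneousComponent_isHomogeneous K.totalDegree K using 1
    omega
  · rw [← homogeneousComponent_add_mul le_rfl le_rfl, ← homogeneousComponent_add_mul
      (totalDegree_mul_of_isDomain hQ0 hQ0).le le_rfl, ← hQK, ← hdeg]
    exact (homogeneousComponent_eq_self hF).symm

theorem totalDegree_pderiv_lt {f : MvPolynomial σ k} (i : σ) (hf : pderiv i f ≠ 0) :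
    (pderiv i f).totalDegree < f.totalDegree := by
  obtain ⟨m, hm, hdeg⟩ := Finset.exists_mem_eq_sup (pderiv i f).support (by simpa using hf)
    (fun s : σ →₀ ℕ ↦ s.sum fun _ e ↦ e)
  have hm' : m + Finsupp.single i 1 ∈ f.support := by
    rw [mem_support_iff, coeff_pderiv] at hm
    exact mem_support_iff.mpr (left_ne_zero_of_mul hm)
  have := le_totalDegree hm'
  rw [Finsupp.sum_add_index' (by simp) (by simp), Finsupp.sum_single_index rfl] at this
  change (pderiv i f).support.sup _ < _
  rw [hdeg]
  omega

theorem exists_pderiv_ne_zero [CharZero k] {f : MvPolynomial σ k} (hf : f.totalDegree ≠ 0) :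
    ∃ i, pderiv i f ≠ 0 := by
  contrapose! hf
  rw [totalDegree_eq_zero_iff]
  intro m hm i
  by_contra hi
  have h := congrArg (coeff (m - Finsupp.single i 1)) (hf i)
  have hle : Finsupp.single i 1 ≤ m := by
    rw [Finsupp.single_le_iff]; omega
  rw [coeff_pderiv, coeff_zero, tsub_add_cancel_of_le hle] at h
  rcases mul_eq_zero.mp h with h | h
  · exact mem_support_iff.mp hm h
  · exact absurd h (by norm_cast)

end Forms

section Points

variable {k : Type} [Field k]

/-- The derivative of polynomials in the direction `v`. -/
noncomputable def dirDeriv (v : Fin 3 → k) :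
    Derivation k (MvPolynomial (Fin 3) k) (MvPolynomial (Fin 3) k) :=
  ∑ i, v i • pderiv i

theorem dirDeriv_apply (v : Fin 3 → k) (f : MvPolynomial (Fin 3) k) :
    dirDeriv v f = ∑ i, v i • pderiv i f := by
  rw [dirDeriv, ← Derivation.coeFnAddMonoidHom_apply, map_sum, Finset.sum_apply]
  rfl

theorem dirDeriv_single (i : Fin 3) (f : MvPolynomial (Fin 3) k) :
    dirDeriv (Pi.single i 1) f = pderiv i f := by
  rw [dirDeriv_apply, Finset.sum_eq_single i] <;> simp +contextual

theorem MvPolynomial.IsHomogeneous.dirDeriv {n : ℕ} {f : MvPolynomial (Fin 3) k}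
    (hf : f.IsHomogeneous n) (v : Fin 3 → k) : (dirDeriv v f).IsHomogeneous (n - 1) := by
  rw [dirDeriv_apply, ← mem_homogeneousSubmodule]
  exact Submodule.sum_mem _ fun i _ ↦ Submodule.smul_mem _ _ hf.pderiv

theorem MvPolynomial.IsHomogeneous.aeval_mul_eq {σ R S : Type*} [CommSemiring R] [CommSemiring S]
    [Algebra R S] {n : ℕ} {f : MvPolynomial σ R} (hf : f.IsHomogeneous n) (r : S) (x : σ → S) :
    MvPolynomial.aeval (fun i ↦ r * x i) f = r ^ n * MvPolynomial.aeval x f := by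
  simp only [aeval_def, eval₂_eq, Finset.mul_sum]
  refine Finset.sum_congr rfl fun m hm ↦ ?_
  rw [hf.degree_eq_sum_deg_support hm]
  simp only [mul_pow, Finset.prod_mul_distrib, Finset.prod_pow_eq_pow_sum]
  ring

theorem mem_pointIdeal_of_eval_eq_zero {P : Projectivization k (Fin 3 → k)} {n : ℕ}
    {f : MvPolynomial (Fin 3) k} (hf : f.IsHomogeneous n) (h : eval P.rep f = 0) :
    f ∈ pointIdeal k P := by
  obtain ⟨j, hj⟩ := Function.ne_iff.mp P.rep_nonzero
  rw [Pi.zero_apply] at hj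
  let g : MvPolynomial (Fin 3) k →ₐ[k] MvPolynomial (Fin 3) k :=
    aeval fun i ↦ (C (P.rep j)⁻¹ * X j) * C (P.rep i)
  have hg : (Ideal.Quotient.mkₐ k (pointIdeal k P)).comp g =
      Ideal.Quotient.mkₐ k (pointIdeal k P) := by
    refine algHom_ext fun i ↦ ?_
    simp only [AlgHom.comp_apply, g, aeval_X]
    refine Ideal.Quotient.eq.mpr (Ideal.subset_span ⟨?_, ?_⟩)
    · refine .sub ?_ (isHomogeneous_X _ _)
      simpa using ((isHomogeneous_C _ _).mul (isHomogeneous_X k j)).mul (isHomogeneous_C _ _)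
    · simp
      field_simp
      simp
  have hgf : g f = 0 := by
    have : aeval (fun i ↦ C (P.rep i)) f = (C (eval P.rep f) : MvPolynomial (Fin 3) k) := by
      rw [← aeval_eq_eval]
      exact aeval_algebraMap_apply _ P.rep f
    simp only [g]
    rw [hf.aeval_mul_eq, this, h]
    simp
  have := DFunLike.congr_fun hg f
  rw [AlgHom.comp_apply, hgf, map_zero] at this
  exact Ideal.Quotient.eq_zero_iff_mem.mp this.symm

theorem pointIdeal_le_ker_eval (P : Projectivization k (Fin 3 → k)) :
    pointIdeal k P ≤ RingHom.ker (eval P.rep) :=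
  Ideal.span_le.mpr fun _ hf ↦ hf.2

theorem eval_dirDeriv_eq_zero_of_mem_sq {P : Projectivization k (Fin 3 → k)}
    {f : MvPolynomial (Fin 3) k} (hf : f ∈ pointIdeal k P ^ 2) (v : Fin 3 → k) :
    eval P.rep (dirDeriv v f) = 0 := by
  rw [pow_two] at hf
  refine Submodule.mul_induction_on hf (fun a ha b hb ↦ ?_) fun a b ha hb ↦ ?_
  · have ha := pointIdeal_le_ker_eval P ha
    have hb := pointIdeal_le_ker_eval P hb
    rw [RingHom.mem_ker] at ha hb
    simp [ha, hb]
  · rw [map_add, map_add, ha, hb, add_zero]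

/-- Every linear functional on `k³` is given by a linear form. -/
theorem exists_linearForm (φ : (Fin 3 → k) →ₗ[k] k) :
    ∃ L : MvPolynomial (Fin 3) k, L.IsHomogeneous 1 ∧ (∀ x, eval x L = φ x) ∧
      ∀ v, dirDeriv v L = C (φ v) := by
  have hφ : ∀ x : Fin 3 → k, φ x = ∑ i, x i * φ (Pi.single i 1) := by
    intro x
    conv_lhs => rw [LinearMap.pi_apply_eq_sum_univ φ x]
    simp only [smul_eq_mul]
    refine Finset.sum_congr rfl fun i _ ↦ ?_
    congr 2
    ext j
    simp [Pi.single_apply, eq_comm]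
  refine ⟨∑ i, C (φ (Pi.single i 1)) * X i, ?_, fun x ↦ ?_, fun v ↦ ?_⟩
  · exact IsHomogeneous.sum _ _ _ fun i _ ↦ isHomogeneous_C_mul_X _ _
  · rw [hφ x]
    simp [mul_comm]
  · rw [hφ v, dirDeriv_apply]
    simp [pderiv_X, Fin.sum_univ_three, Pi.single_apply, smul_eq_C_mul]

theorem exists_linearForm_of_linearIndependent {u v : Fin 3 → k}
    (h : LinearIndependent k ![u, v]) (a b : k) :
    ∃ L : MvPolynomial (Fin 3) k, L.IsHomogeneous 1 ∧ eval u L = a ∧ eval v L = b ∧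
      dirDeriv v L = C b := by
  obtain ⟨φ, hφ⟩ := LinearMap.exists_extend ((Module.Basis.span h).constr k ![a, b])
  have hφi : ∀ i, φ (![u, v] i) = ![a, b] i := by
    intro i
    have := Module.Basis.constr_basis (Module.Basis.span h) k ![a, b] i
    rwa [← hφ, LinearMap.comp_apply, Submodule.subtype_apply, Module.Basis.span_apply] at this
  obtain ⟨L, hL, hev, hd⟩ := exists_linearForm φ
  exact ⟨L, hL, (hev u).trans (hφi 0), (hev v).trans (hφi 1), (hd v).trans (congrArg C (hφi 1))⟩

theorem linearIndependent_rep_pair {P Q : Projectivization k (Fin 3 → k)} (h : P ≠ Q) :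
    LinearIndependent k ![P.rep, Q.rep] := by
  have := (Projectivization.independent_pair_iff_ne P Q).mpr h
  rw [Projectivization.independent_iff] at this
  have h2 : Projectivization.rep ∘ ![P, Q] = ![P.rep, Q.rep] := by
    ext i
    fin_cases i <;> rfl
  rwa [h2] at this

/-- Every linear condition on tangent vectors is met by one independent of a given vector. -/
theorem exists_linearIndependent_pair_mem_ker {p : Fin 3 → k} (hp : p ≠ 0)
    (φ : (Fin 3 → k) →ₗ[k] k) :
    ∃ v, φ v = 0 ∧ LinearIndependent k ![p, v] := by
  by_contra! h
  have hle : LinearMap.ker φ ≤ k ∙ p := by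
    intro v hv
    have := h v hv
    rw [LinearIndependent.pair_iff' hp] at this
    push Not at this
    exact Submodule.mem_span_singleton.mpr this
  have h1 := Submodule.finrank_mono hle
  rw [finrank_span_singleton hp] at h1
  have h2 := φ.finrank_range_add_finrank_ker
  have h3 := Submodule.finrank_le (LinearMap.range φ)
  simp at h2 h3
  omega

end Points

section Counting

variable {k : Type} [Field k]

/-- A squarefree polynomial has no factor in common with a general directional derivative. -/
theorem exists_isRelPrime_dirDeriv [CharZero k] {F : MvPolynomial (Fin 3) k}
    (hsq : Squarefree F) : ∃ w, IsRelPrime F (dirDeriv w F) := by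
  have hF0 : F ≠ 0 := hsq.ne_zero
  let V : MvPolynomial (Fin 3) k → Submodule k (Fin 3 → k) := fun Q ↦
    LinearMap.ker (Fintype.linearCombination k fun i ↦ pderiv i Q)
  have hV : ∀ Q w, w ∈ V Q ↔ dirDeriv w Q = 0 := fun Q w ↦ by
    rw [dirDeriv_apply, LinearMap.mem_ker, Fintype.linearCombination_apply]
  classical
  have htop : ⊤ ∉ (UniqueFactorizationMonoid.factors F).toFinset.image V := by
    simp only [Finset.mem_image, Multiset.mem_toFinset, not_exists, not_and]
    intro Q hQ htop
    have hirr := UniqueFactorizationMonoid.irreducible_of_factor Q hQ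
    obtain ⟨i, hi⟩ := exists_pderiv_ne_zero (f := Q) fun h0 ↦ by
      rw [totalDegree_eq_zero_iff_eq_C] at h0
      have hQ0 := hirr.ne_zero
      refine hirr.not_isUnit ?_
      rw [h0] at hQ0 ⊢
      exact (IsUnit.mk0 _ fun h ↦ by simp [h] at hQ0).map C
    refine hi ?_
    rw [← dirDeriv_single, ← hV, htop]
    exact Submodule.mem_top
  obtain ⟨w, hw⟩ := (Set.ne_univ_iff_exists_notMem _).mp
    (Subspace.biUnion_ne_univ_of_top_notMem htop)
  refine ⟨w, WfDvdMonoid.isRelPrime_of_no_irreducible_factors (by simp [hF0]) ?_⟩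
  intro Q₀ hQ₀ hQ₀F hQ₀D
  obtain ⟨Q, hQ, hass⟩ := UniqueFactorizationMonoid.exists_mem_factors_of_dvd hF0 hQ₀ hQ₀F
  have hdQ : dirDeriv w Q ≠ 0 := by
    rw [Ne, ← hV]
    intro h
    exact hw (Set.mem_biUnion (Finset.mem_coe.mpr (Finset.mem_image_of_mem V
      (Multiset.mem_toFinset.mpr hQ))) h)
  have hprime := UniqueFactorizationMonoid.prime_of_factor Q hQ
  obtain ⟨K, rfl⟩ := hass.symm.dvd.trans hQ₀F
  have hD := hass.symm.dvd.trans hQ₀D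
  rw [Derivation.leibniz, smul_eq_mul, smul_eq_mul, dvd_add_right (dvd_mul_right Q _)] at hD
  rcases hprime.dvd_or_dvd hD with hK | hQD
  · exact hprime.not_isUnit (hsq Q (mul_dvd_mul_left Q hK))
  · have h1 := totalDegree_le_of_dvd_of_isDomain hQD hdQ
    obtain ⟨i, hi⟩ : ∃ i, pderiv i Q ≠ 0 := by
      by_contra! h
      exact hdQ (by simp [dirDeriv_apply, h])
    have h2 : (dirDeriv w Q).totalDegree < Q.totalDegree := by
      have hpos := (Nat.zero_le _).trans_lt (totalDegree_pderiv_lt i hi)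
      rw [dirDeriv_apply]
      refine (totalDegree_finsetSum _ _).trans_lt ((Finset.sup_lt_iff hpos).mpr fun j _ ↦ ?_)
      refine (totalDegree_smul_le _ _).trans_lt ?_
      by_cases hj : pderiv j Q = 0
      · simpa [hj] using hpos
      · exact totalDegree_pderiv_lt j hj
    omega

/-- A lower bound for the dimension of the degree `c + d + e` part of an ideal containing
relatively prime forms `F` and `G` of degrees `d` and `e`. -/
theorem finrank_add_le_of_isRelPrime {σ : Type*} [Finite σ] {c d e : ℕ} {F G : MvPolynomial σ k}
    (hF : F.IsHomogeneous d) (hF0 : F ≠ 0) (hFG : IsRelPrime F G)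
    (K : Submodule k (MvPolynomial σ k)) [Module.Finite k K]
    (hKF : ∀ A, A.IsHomogeneous (c + e) → A * F ∈ K)
    (hKG : ∀ B, B.IsHomogeneous (c + d) → B * G ∈ K) (hG : G.IsHomogeneous e) :
    Module.finrank k (homogeneousSubmodule σ k (c + e)) +
      Module.finrank k (homogeneousSubmodule σ k (c + d)) ≤
    Module.finrank k (homogeneousSubmodule σ k c) + Module.finrank k K := by
  let Φ : homogeneousSubmodule σ k (c + e) × homogeneousSubmodule σ k (c + d) →ₗ[k] K :=
    LinearMap.codRestrict K
      (LinearMap.coprod (LinearMap.mulRight k F ∘ₗ Submodule.subtype _)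
        (LinearMap.mulRight k G ∘ₗ Submodule.subtype _))
      fun x ↦ K.add_mem (hKF _ x.1.2) (hKG _ x.2.2)
  let Ψ : homogeneousSubmodule σ k c →ₗ[k]
      homogeneousSubmodule σ k (c + e) × homogeneousSubmodule σ k (c + d) :=
    LinearMap.prod
      (LinearMap.codRestrict _ (-(LinearMap.mulRight k G ∘ₗ Submodule.subtype _))
        fun x ↦ Submodule.neg_mem _ (IsHomogeneous.mul x.2 hG))
      (LinearMap.codRestrict _ (LinearMap.mulRight k F ∘ₗ Submodule.subtype _)
        fun x ↦ IsHomogeneous.mul x.2 hF)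
  have hker : LinearMap.ker Φ ≤ LinearMap.range Ψ := by
    rintro ⟨⟨A, hA⟩, ⟨B, hB⟩⟩ h
    have h0 : A * F + B * G = 0 := congrArg Subtype.val (LinearMap.mem_ker.mp h)
    have hdvd : F ∣ B * G := by
      rw [← dvd_add_right (dvd_mul_left F A), h0]
      exact dvd_zero F
    obtain ⟨D, rfl⟩ := hFG.dvd_of_dvd_mul_right hdvd
    have hD : D.IsHomogeneous c := hF.of_mul_left hF0 (by rwa [add_comm d c])
    have hAD : A = -(D * G) := by
      refine mul_right_cancel₀ hF0 ?_
      linear_combination h0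
    exact ⟨⟨D, hD⟩, Prod.ext (Subtype.ext hAD.symm) (Subtype.ext (mul_comm D F))⟩
  have h1 := Φ.finrank_range_add_finrank_ker
  have h2 := (LinearMap.range Φ).finrank_le
  have h3 := Submodule.finrank_mono hker
  have h4 := Ψ.finrank_range_le
  rw [Module.finrank_prod] at h1
  omega

theorem eval_dirDeriv_eq_zero_of_sq_dvd {p : Fin 3 → k} {L f : MvPolynomial (Fin 3) k}
    (hL : eval p L = 0) (h : L ^ 2 ∣ f) : eval p f = 0 ∧ ∀ v, eval p (dirDeriv v f) = 0 := by
  obtain ⟨g, rfl⟩ := h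
  simp [pow_two, hL]

/-- Forms of degree `2 (s - 1) + 1` separate first-order data at `s` points of the plane. -/
theorem exists_form_eval_dirDeriv {s : ℕ} {P : Fin (s + 1) → Projectivization k (Fin 3 → k)}
    (hinj : Function.Injective P) (v : Fin (s + 1) → Fin 3 → k)
    (hv : ∀ i, LinearIndependent k ![(P i).rep, v i]) (y : Fin (s + 1) → k × k) :
    ∃ f : MvPolynomial (Fin 3) k, f.IsHomogeneous (2 * s + 1) ∧
      ∀ i, (eval (P i).rep f, eval (P i).rep (dirDeriv (v i) f)) = y i := by
  have hone : ∀ i, ∃ f : MvPolynomial (Fin 3) k, f.IsHomogeneous (2 * s + 1) ∧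
      (eval (P i).rep f, eval (P i).rep (dirDeriv (v i) f)) = y i ∧
      ∀ j, j ≠ i → eval (P j).rep f = 0 ∧ eval (P j).rep (dirDeriv (v j) f) = 0 := by
    intro i
    have hL : ∀ j, ∃ L : MvPolynomial (Fin 3) k, L.IsHomogeneous 1 ∧
        (j ≠ i → eval (P j).rep L = 0 ∧ eval (P i).rep L ≠ 0) := by
      intro j
      by_cases hj : j = i
      · exact ⟨0, isHomogeneous_zero _ _ _, fun h ↦ absurd hj h⟩
      · obtain ⟨L, h1, h2, h3, -⟩ := exists_linearForm_of_linearIndependent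
          (linearIndependent_rep_pair (hinj.ne hj)) 0 1
        exact ⟨L, h1, fun _ ↦ ⟨h2, by simp [h3]⟩⟩
    choose L hL1 hL2 using hL
    set U := ∏ j ∈ Finset.univ.erase i, L j ^ 2 with hU
    have hUdeg : U.IsHomogeneous (2 * s) := by
      have := IsHomogeneous.prod (Finset.univ.erase i) (fun j ↦ L j ^ 2) (fun _ ↦ 1 * 2)
        fun j _ ↦ (hL1 j).pow 2
      simpa [mul_comm] using this
    have hU0 : eval (P i).rep U ≠ 0 := by
      rw [hU, map_prod, Finset.prod_ne_zero_iff]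
      intro j hj
      rw [map_pow]
      exact pow_ne_zero 2 (hL2 j (Finset.ne_of_mem_erase hj)).2
    set u := eval (P i).rep U
    obtain ⟨M, hM1, hM2, -, hM3⟩ := exists_linearForm_of_linearIndependent (hv i) ((y i).1 / u)
      (((y i).2 - (y i).1 / u * eval (P i).rep (dirDeriv (v i) U)) / u)
    refine ⟨U * M, hUdeg.mul hM1, Prod.ext ?_ ?_, fun j hj ↦ ?_⟩
    · rw [map_mul, hM2]
      exact mul_div_cancel₀ _ hU0
    · simp only [Derivation.leibniz, map_add, smul_eq_mul, map_mul, hM2, hM3, eval_C]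
      rw [mul_div_cancel₀ _ hU0]
      ring
    · have := eval_dirDeriv_eq_zero_of_sq_dvd (hL2 j hj).1 (Dvd.dvd.mul_right
        (Finset.dvd_prod_of_mem (fun j ↦ L j ^ 2)
          (Finset.mem_erase.mpr ⟨hj, Finset.mem_univ j⟩)) M)
      exact ⟨this.1, this.2 _⟩
  choose f hf1 hf2 hf3 using hone
  refine ⟨∑ i, f i, IsHomogeneous.sum _ _ _ fun i _ ↦ hf1 i, fun i ↦ ?_⟩
  rw [← hf2 i]
  simp only [map_sum]
  rw [Finset.sum_eq_single i (fun j _ hj ↦ (hf3 j i hj.symm).1) (by simp),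
    Finset.sum_eq_single i (fun j _ hj ↦ (hf3 j i hj.symm).2) (by simp)]

end Counting

section SingularForms

variable {k : Type} [Field k]

/-- The forms of degree `2 * s + 1` vanishing at `s + 1` points together with their derivatives in
given directions form a space of codimension `2 * (s + 1)`. -/
theorem exists_submodule_eval_dirDeriv {s : ℕ} {P : Fin (s + 1) → Projectivization k (Fin 3 → k)}
    (hinj : Function.Injective P) (v : Fin (s + 1) → Fin 3 → k)
    (hv : ∀ i, LinearIndependent k ![(P i).rep, v i]) :
    ∃ K : Submodule k (MvPolynomial (Fin 3) k), Module.Finite k K ∧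
      Module.finrank k K + 2 * (s + 1) = (2 * s + 1 + 2).choose 2 ∧
      ∀ f : MvPolynomial (Fin 3) k, f.IsHomogeneous (2 * s + 1) →
        (∀ i, eval (P i).rep f = 0 ∧ eval (P i).rep (dirDeriv (v i) f) = 0) → f ∈ K := by
  obtain ⟨jet, hjet⟩ : ∃ jet : homogeneousSubmodule (Fin 3) k (2 * s + 1) →ₗ[k]
      Fin (s + 1) → k × k,
      ∀ x i, jet x i = (eval (P i).rep x.1, eval (P i).rep (dirDeriv (v i) x.1)) :=
    ⟨LinearMap.pi fun i ↦ ((aeval (R := k) (P i).rep).toLinearMap.prod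
      ((aeval (R := k) (P i).rep).toLinearMap ∘ₗ (dirDeriv (v i)).toLinearMap)) ∘ₗ
        Submodule.subtype _, fun x i ↦ rfl⟩
  have hsurj : LinearMap.range jet = ⊤ := by
    refine LinearMap.range_eq_top.mpr fun y ↦ ?_
    obtain ⟨f, hf, hfy⟩ := exists_form_eval_dirDeriv hinj v hv y
    refine ⟨⟨f, hf⟩, ?_⟩
    ext1 i
    rw [hjet]
    exact hfy i
  refine ⟨(LinearMap.ker jet).map (Submodule.subtype _), inferInstance, ?_, fun f hf h ↦ ?_⟩
  swap
  · refine Submodule.mem_map_of_mem (f := Submodule.subtype _) (r := ⟨f, hf⟩) ?_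
    rw [LinearMap.mem_ker]
    ext1 i
    rw [hjet]
    exact Prod.ext (h i).1 (h i).2
  rw [Submodule.finrank_map_subtype_eq]
  have := jet.finrank_range_add_finrank_ker
  rw [hsurj, finrank_top, finrank_homogeneousSubmodule_fin_three] at this
  simp only [Module.finrank_pi_fintype, Module.finrank_prod, Module.finrank_self,
    Finset.sum_const, Finset.card_univ, Fintype.card_fin, smul_eq_mul] at this
  omega

/-- A squarefree form of degree `d` has at most `d.choose 2` singular points. -/
theorem not_squarefree_of_singular [CharZero k] {d s : ℕ} (hd : 3 ≤ d) (hs : s = d.choose 2)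
    {P : Fin (s + 1) → Projectivization k (Fin 3 → k)} (hinj : Function.Injective P)
    {F : MvPolynomial (Fin 3) k} (hF : F.IsHomogeneous d)
    (hP : ∀ i, eval (P i).rep F = 0) (hPd : ∀ i v, eval (P i).rep (dirDeriv v F) = 0) :
    ¬ Squarefree F := by
  intro hsq
  obtain ⟨w, hw⟩ := exists_isRelPrime_dirDeriv hsq
  have hv : ∀ i, ∃ v, eval (P i).rep (dirDeriv v (dirDeriv w F)) = 0 ∧
      LinearIndependent k ![(P i).rep, v] := by
    intro i
    obtain ⟨v, h1, h2⟩ := exists_linearIndependent_pair_mem_ker (P i).rep_nonzero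
      (Fintype.linearCombination k fun j ↦ eval (P i).rep (pderiv j (dirDeriv w F)))
    refine ⟨v, ?_, h2⟩
    rw [← h1, Fintype.linearCombination_apply, dirDeriv_apply v, map_sum]
    simp [smul_eval]
  choose v hv1 hv2 using hv
  obtain ⟨K, hfin, hK, hmem⟩ := exists_submodule_eval_dirDeriv hinj v hv2
  have h2s : 2 * s = d * (d - 1) := by
    rw [hs, Nat.choose_two_right, Nat.mul_div_cancel' (Nat.even_mul_pred_self d).two_dvd]
  obtain ⟨m, rfl⟩ := Nat.exists_eq_add_of_le' hd
  have hdeg : 2 * s + 1 = (m + 2) * (m + 1) + (m + 3) + (m + 2) := by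
    rw [h2s, show m + 3 - 1 = m + 2 by omega]
    ring
  have hle := finrank_add_le_of_isRelPrime (c := (m + 2) * (m + 1)) (e := m + 2) hF hsq.ne_zero
    hw K
    (fun A hA ↦ hmem _ (by convert hA.mul hF using 1; omega) fun i ↦ by simp [hP, hPd])
    (fun B hB ↦ hmem _ (by rw [hdeg]; exact hB.mul (hF.dirDeriv w))
      fun i ↦ by simp [hPd, hv1]) (hF.dirDeriv w)
  simp only [finrank_homogeneousSubmodule_fin_three] at hle
  have hch : ∀ n : ℕ, 2 * (n + 2).choose 2 = (n + 2) * (n + 1) := fun n ↦ by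
    rw [Nat.choose_two_right, Nat.mul_div_cancel' (Nat.even_mul_pred_self _).two_dvd,
      show n + 2 - 1 = n + 1 by omega]
  have h1 := hch ((m + 2) * (m + 1))
  have h2 := hch ((m + 2) * (m + 1) + (m + 3))
  have h3 := hch ((m + 2) * (m + 1) + (m + 2))
  have h4 := hch (2 * s + 1)
  rw [hdeg] at h4 hK
  clear hch hmem hs
  generalize ((m + 2) * (m + 1) + 2).choose 2 = c₁ at *
  generalize ((m + 2) * (m + 1) + (m + 3) + 2).choose 2 = c₂ at *
  generalize ((m + 2) * (m + 1) + (m + 2) + 2).choose 2 = c₃ at *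
  generalize ((m + 2) * (m + 1) + (m + 3) + (m + 2) + 2).choose 2 = c₄ at *
  nlinarith

/-- If no form of degree `d - 2` passes through `d.choose 2 + 1` points, then no form of degree
`d` is singular at all of them. -/
theorem eq_zero_of_singular [CharZero k] {d : ℕ} (hd : 3 ≤ d)
    {P : Fin (d.choose 2 + 1) → Projectivization k (Fin 3 → k)} (hinj : Function.Injective P)
    (hgen : ∀ G : MvPolynomial (Fin 3) k, G.IsHomogeneous (d - 2) →
      (∀ i, eval (P i).rep G = 0) → G = 0)
    {F : MvPolynomial (Fin 3) k} (hF : F.IsHomogeneous d)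
    (hP : ∀ i, eval (P i).rep F = 0) (hPd : ∀ i v, eval (P i).rep (dirDeriv v F) = 0) :
    F = 0 := by
  by_contra hF0
  obtain ⟨e, Q, K, he1, hed, hQ, hK, rfl⟩ := exists_isHomogeneous_sq_mul hF hF0
    (not_squarefree_of_singular hd rfl hinj hF hP hPd)
  have hQ0 : Q ≠ 0 := by rintro rfl; simp at hF0
  have hK0 : K ≠ 0 := by rintro rfl; simp at hF0
  have hQK : ∀ i, eval (P i).rep Q = 0 ∨ eval (P i).rep K = 0 := fun i ↦ by
    simpa using hP i
  rcases he1.eq_or_lt with rfl | he2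
  · obtain ⟨j, hj⟩ := exists_pderiv_ne_zero (f := K) (by rw [hK.totalDegree hK0]; omega)
    refine mul_ne_zero hQ0 hj (hgen _ ?_ fun i ↦ ?_)
    · convert hQ.mul (hK.pderiv (i := j)) using 1
      omega
    · have h := hPd i (Pi.single j 1)
      rw [dirDeriv_single] at h
      rcases hQK i with hq | hq
      · simp [hq]
      · simpa [hq] using h
  · refine mul_ne_zero (mul_ne_zero hQ0 hK0) (pow_ne_zero (e - 2) (X_ne_zero (0 : Fin 3)))
      (hgen _ ?_ fun i ↦ ?_)
    · convert (hQ.mul hK).mul (isHomogeneous_X_pow (R := k) (0 : Fin 3) (e - 2)) using 1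
      omega
    · rcases hQK i with hq | hq <;> simp [hq]

theorem eq_zero_of_hasGenericHilbertFunction {d s : ℕ} (hd : 2 ≤ d) (hs : d.choose 2 ≤ s)
    {P : Fin s → Projectivization k (Fin 3 → k)} (hgen : HasGenericHilbertFunction k P)
    {G : MvPolynomial (Fin 3) k} (hG : G.IsHomogeneous (d - 2))
    (hGP : ∀ i, eval (P i).rep G = 0) : G = 0 := by
  have h := hgen (d - 2)
  rw [hilbertFunction, finrank_homogeneousSubmodule_fin_three, Nat.sub_add_cancel hd,
    min_eq_right hs] at h
  have hpos := Nat.choose_pos hd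
  set W := Submodule.restrictScalars k (idealOfPoints k P) ⊓ homogeneousSubmodule (Fin 3) k (d - 2)
    with hW
  have : Module.Finite k W := Submodule.finiteDimensional_of_le inf_le_right
  have hbot : W = ⊥ := Submodule.finrank_eq_zero.mp (by omega)
  rw [← Submodule.mem_bot k, ← hbot]
  exact ⟨Submodule.mem_iInf _ |>.mpr fun i ↦ mem_pointIdeal_of_eval_eq_zero hG (hGP i), hG⟩

end SingularForms

/-- If X is a set of binom(d,2)+1 distinct points of ℙ² (d ≥ 3) with generic
Hilbert function, then H_{2X}(t) = binom(t+2,2) for all t ≤ d. -/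
theorem statement2 (k : Type) [Field k] [IsAlgClosed k] [CharZero k]
    (d : ℕ) (hd : 3 ≤ d)
    (P : Fin (Nat.choose d 2 + 1) → Projectivization k (Fin 3 → k))
    (hinj : Function.Injective P) (hgen : HasGenericHilbertFunction k P) :
    ∀ t : ℕ, t ≤ d →
      hilbertFunction k (doubleIdealOfPoints k P) t = Nat.choose (t + 2) 2 := by
  intro t ht
  have hbot : Submodule.restrictScalars k (doubleIdealOfPoints k P) ⊓
      homogeneousSubmodule (Fin 3) k t = ⊥ := by
    refine (Submodule.eq_bot_iff _).mpr fun F ⟨hF, hFt⟩ ↦ ?_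
    have hFX : ∀ i, F * X 0 ^ (d - t) ∈ pointIdeal k (P i) ^ 2 := fun i ↦
      Ideal.mul_mem_right _ _ ((Submodule.mem_iInf _).mp hF i)
    have h0 : F * X 0 ^ (d - t) = 0 := by
      refine eq_zero_of_singular hd hinj
        (fun G ↦ eq_zero_of_hasGenericHilbertFunction (by omega) (Nat.le_succ _) hgen) ?_
        (fun i ↦ pointIdeal_le_ker_eval _ (Ideal.pow_le_self two_ne_zero (hFX i)))
        fun i ↦ eval_dirDeriv_eq_zero_of_mem_sq (hFX i)
      convert IsHomogeneous.mul hFt (isHomogeneous_X_pow (R := k) (0 : Fin 3) (d - t)) using 1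
      omega
    exact (mul_eq_zero.mp h0).resolve_right (pow_ne_zero _ (X_ne_zero _))
  rw [hilbertFunction, hbot, finrank_bot, finrank_homogeneousSubmodule_fin_three, Nat.sub_zero]
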